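/- arXiv:1310.8342 — 11 statements merged into one kernel-verified Lean document; each statement's English description precedes it below -/
import Mathlib

section
/- The function Φ₂ is strictly increasing and strictly convex in S on [0, ∞). -/
open MeasureTheory Real Set

/-- The minimum transmission-power-to-noise ratio achieving spectral efficiency `S`
for a fast-varying channel with channel distribution information at the transmitter. -/
noncomputable def Phi2 (μ : Measure ℝ) (S : ℝ) : ℝ :=
  sInf {p : ℝ | 0 ≤ p ∧ S ≤ ∫ g, logb 2 (1 + g * p) ∂μ}

lemma integral_lt_integral_of_ae_lt {α : Type*} [MeasurableSpace α] {μ : Measure α} [NeZero μ]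
    {f h : α → ℝ} (hf : Integrable f μ) (hh : Integrable h μ) (hlt : ∀ᵐ x ∂μ, f x < h x) :
    ∫ x, f x ∂μ < ∫ x, h x ∂μ := by
  have hle : f ≤ᵐ[μ] h := hlt.mono fun _ hx => hx.le
  refine (integral_mono_ae hf hh hle).lt_of_ne fun heq => ?_
  obtain ⟨x, hx, hx'⟩ := (hlt.and ((integral_eq_iff_of_ae_le hf hh hle).1 heq)).exists
  exact hx.ne hx'

section auxiliary

variable {μ : Measure ℝ}

/-- The ergodic spectral efficiency at transmission-power-to-noise ratio `p`. -/
noncomputable def ergodicRate (μ : Measure ℝ) (p : ℝ) : ℝ :=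
  ∫ g, logb 2 (1 + g * p) ∂μ

lemma logb_two_one_add_mul_nonneg {g p : ℝ} (hg : 0 < g) (hp : 0 ≤ p) :
    0 ≤ logb 2 (1 + g * p) :=
  logb_nonneg one_lt_two (by linarith [mul_nonneg hg.le hp])

lemma norm_logb_two_one_add_mul_le {g p q : ℝ} (hg : 0 < g) (hp : 0 ≤ p) (hpq : p ≤ q) :
    ‖logb 2 (1 + g * p)‖ ≤ g * (q / log 2) := by
  rw [norm_of_nonneg (logb_two_one_add_mul_nonneg hg hp), logb, ← mul_div_assoc]
  have hgp := mul_nonneg hg.le hp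
  gcongr
  linarith [log_le_sub_one_of_pos (show 0 < 1 + g * p by linarith),
    mul_le_mul_of_nonneg_left hpq hg.le]

lemma measurable_logb_two_one_add_mul (p : ℝ) :
    Measurable fun g : ℝ => logb 2 (1 + g * p) := by
  unfold logb
  fun_prop

lemma integrable_logb_two_one_add_mul (hpos : ∀ᵐ g ∂μ, 0 < g) (hmean : Integrable id μ)
    {p : ℝ} (hp : 0 ≤ p) : Integrable (fun g => logb 2 (1 + g * p)) μ :=
  (hmean.mul_const (p / log 2)).mono' (measurable_logb_two_one_add_mul p).aestronglyMeasurable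
    (hpos.mono fun _ hg => norm_logb_two_one_add_mul_le hg hp le_rfl)

lemma strictMonoOn_ergodicRate [NeZero μ] (hpos : ∀ᵐ g ∂μ, 0 < g) (hmean : Integrable id μ) :
    StrictMonoOn (ergodicRate μ) (Ici 0) := by
  intro p hp q hq hpq
  rw [mem_Ici] at hp hq
  refine integral_lt_integral_of_ae_lt (integrable_logb_two_one_add_mul hpos hmean hp)
    (integrable_logb_two_one_add_mul hpos hmean hq) (hpos.mono fun g hg => ?_)
  have hgp := mul_nonneg hg.le hp
  exact logb_lt_logb one_lt_two (by linarith) (by gcongr)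

lemma strictConcaveOn_logb_two_one_add_mul {g : ℝ} (hg : 0 < g) :
    StrictConcaveOn ℝ (Ici 0) fun p => logb 2 (1 + g * p) := by
  refine ⟨convex_Ici 0, fun p hp q hq hpq a b ha hb hab => ?_⟩
  rw [mem_Ici] at hp hq
  have hgp := mul_nonneg hg.le hp
  have hgq := mul_nonneg hg.le hq
  have hne : 1 + g * p ≠ 1 + g * q := fun h =>
    hpq (mul_left_cancel₀ hg.ne' (add_left_cancel h))
  have h := strictConcaveOn_log_Ioi.2 (show 1 + g * p ∈ Ioi 0 by rw [mem_Ioi]; linarith)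
    (show 1 + g * q ∈ Ioi 0 by rw [mem_Ioi]; linarith) hne ha hb hab
  have harg : a • (1 + g * p) + b • (1 + g * q) = 1 + g * (a • p + b • q) := by
    simp only [smul_eq_mul]
    linear_combination hab
  rw [harg] at h
  have hlog : 0 < log 2 := log_pos one_lt_two
  simp only [smul_eq_mul, logb] at h ⊢
  rw [← mul_div_assoc, ← mul_div_assoc, ← add_div]
  gcongr

lemma strictConcaveOn_ergodicRate [NeZero μ] (hpos : ∀ᵐ g ∂μ, 0 < g)
    (hmean : Integrable id μ) : StrictConcaveOn ℝ (Ici 0) (ergodicRate μ) := by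
  refine ⟨convex_Ici 0, fun p hp q hq hpq a b ha hb hab => ?_⟩
  have hip := (integrable_logb_two_one_add_mul hpos hmean hp).const_mul a
  have hiq := (integrable_logb_two_one_add_mul hpos hmean hq).const_mul b
  have hmem : a • p + b • q ∈ Ici (0 : ℝ) := convex_Ici 0 hp hq ha.le hb.le hab
  simp only [ergodicRate, smul_eq_mul] at hmem ⊢
  rw [← integral_const_mul, ← integral_const_mul, ← integral_add hip hiq]
  exact integral_lt_integral_of_ae_lt (hip.add hiq)
    (integrable_logb_two_one_add_mul hpos hmean hmem)
    (hpos.mono fun g hg => (strictConcaveOn_logb_two_one_add_mul hg).2 hp hq hpq ha hb hab)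

lemma continuousOn_ergodicRate (hpos : ∀ᵐ g ∂μ, 0 < g) (hmean : Integrable id μ) (P : ℝ) :
    ContinuousOn (ergodicRate μ) (Icc 0 P) := by
  refine continuousOn_of_dominated (bound := fun g => g * (P / log 2))
    (fun p _ => (measurable_logb_two_one_add_mul p).aestronglyMeasurable)
    (fun p hp => hpos.mono fun g hg => norm_logb_two_one_add_mul_le hg hp.1 hp.2)
    (hmean.mul_const _) (hpos.mono fun g hg => ?_)
  refine ContinuousOn.div_const (ContinuousOn.log (by fun_prop) fun p hp => ?_) _
  have := mul_nonneg hg.le hp.1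
  positivity

lemma exists_le_ergodicRate [IsFiniteMeasure μ] [NeZero μ] (hpos : ∀ᵐ g ∂μ, 0 < g)
    (hmean : Integrable id μ) (S : ℝ) : ∃ P, 0 ≤ P ∧ S ≤ ergodicRate μ P := by
  obtain ⟨ε, hε, hμε⟩ : ∃ ε : ℝ, 0 < ε ∧ μ (Ici ε) ≠ 0 := by
    by_contra! h
    have hlt : ∀ᵐ g ∂μ, ∀ n : ℕ, g ∉ Ici (1 / ((n : ℝ) + 1)) :=
      ae_all_iff.2 fun n => measure_eq_zero_iff_ae_notMem.1 (h _ (by positivity))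
    obtain ⟨g, hg, hg0⟩ := (hlt.and hpos).exists
    obtain ⟨n, hn⟩ := exists_nat_one_div_lt hg0
    exact hg n hn.le
  have hm : 0 < μ.real (Ici ε) := ENNReal.toReal_pos hμε (measure_ne_top _ _)
  set T := max S 0 / μ.real (Ici ε)
  have hT0 : 0 ≤ T := by positivity
  set P := ((2 : ℝ) ^ T - 1) / ε with hP
  have hP0 : 0 ≤ P := div_nonneg (sub_nonneg.2 (one_le_rpow one_le_two hT0)) hε.le
  have hlog : logb 2 (1 + ε * P) = T := by
    rw [hP, mul_div_cancel₀ _ hε.ne', add_sub_cancel, logb_rpow two_pos (by norm_num)]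
  refine ⟨P, hP0, ?_⟩
  have hmarkov := mul_meas_ge_le_integral_of_nonneg
    (hpos.mono fun g hg => logb_two_one_add_mul_nonneg hg hP0)
    (integrable_logb_two_one_add_mul hpos hmean hP0) T
  have hsub : Ici ε ⊆ {g | T ≤ logb 2 (1 + g * P)} := by
    intro g hg
    rw [mem_Ici] at hg
    rw [mem_ofPred_eq, ← hlog]
    have := mul_nonneg hε.le hP0
    exact logb_le_logb_of_le one_lt_two (by linarith) (by gcongr)
  calc S ≤ max S 0 := le_max_left _ _
    _ = T * μ.real (Ici ε) := (div_mul_cancel₀ _ hm.ne').symm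
    _ ≤ T * μ.real {g | T ≤ logb 2 (1 + g * P)} := by
      gcongr
      exact measure_ne_top _ _
    _ ≤ ergodicRate μ P := hmarkov

lemma exists_ergodicRate_eq [IsFiniteMeasure μ] [NeZero μ] (hpos : ∀ᵐ g ∂μ, 0 < g)
    (hmean : Integrable id μ) {S : ℝ} (hS : 0 ≤ S) : ∃ p, 0 ≤ p ∧ ergodicRate μ p = S := by
  obtain ⟨P, hP0, hP⟩ := exists_le_ergodicRate hpos hmean S
  have h0 : ergodicRate μ 0 = 0 := by simp [ergodicRate]
  obtain ⟨p, hp, hpS⟩ := intermediate_value_Icc hP0 (continuousOn_ergodicRate hpos hmean P)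
    ⟨h0.le.trans hS, hP⟩
  exact ⟨p, hp.1, hpS⟩

lemma Phi2_ergodicRate [NeZero μ] (hpos : ∀ᵐ g ∂μ, 0 < g) (hmean : Integrable id μ) {p : ℝ}
    (hp : 0 ≤ p) : Phi2 μ (ergodicRate μ p) = p := by
  have hset : {q : ℝ | 0 ≤ q ∧ ergodicRate μ p ≤ ergodicRate μ q} = Ici p := by
    ext q
    refine ⟨fun hq => ?_, fun hq => ?_⟩
    · exact ((strictMonoOn_ergodicRate hpos hmean).le_iff_le hp hq.1).1 hq.2
    · have hq0 : 0 ≤ q := hp.trans hq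
      exact ⟨hq0, ((strictMonoOn_ergodicRate hpos hmean).le_iff_le hp hq0).2 hq⟩
  exact (congrArg sInf hset).trans csInf_Ici

end auxiliary

/-- `Φ₂` is strictly increasing and strictly convex on `[0, ∞)`, where `μ` is a
probability measure on `(0,∞)` (the channel power gain distribution) with finite mean. -/
theorem stmt_1 (μ : Measure ℝ) [IsProbabilityMeasure μ]
    (hsupp : μ (Iic 0) = 0) (hmean : Integrable id μ) :
    StrictMonoOn (Phi2 μ) (Ici 0) ∧ StrictConvexOn ℝ (Ici 0) (Phi2 μ) := by
  have hpos : ∀ᵐ g ∂μ, 0 < g :=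
    (measure_eq_zero_iff_ae_notMem.1 hsupp).mono fun g hg => not_le.1 hg
  have hmono := strictMonoOn_ergodicRate hpos hmean
  have hconc := strictConcaveOn_ergodicRate hpos hmean
  have hPhi {p : ℝ} (hp : 0 ≤ p) := Phi2_ergodicRate hpos hmean hp
  have hPhiMono : StrictMonoOn (Phi2 μ) (Ici 0) := by
    intro S hS T hT hST
    obtain ⟨p, hp, rfl⟩ := exists_ergodicRate_eq hpos hmean hS
    obtain ⟨q, hq, rfl⟩ := exists_ergodicRate_eq hpos hmean hT
    rw [hPhi hp, hPhi hq]
    exact (hmono.lt_iff_lt hp hq).1 hST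
  refine ⟨hPhiMono, convex_Ici 0, fun S hS T hT hST a b ha hb hab => ?_⟩
  have hmem := convex_Ici (0 : ℝ) hS hT ha.le hb.le hab
  obtain ⟨p, hp, rfl⟩ := exists_ergodicRate_eq hpos hmean hS
  obtain ⟨q, hq, rfl⟩ := exists_ergodicRate_eq hpos hmean hT
  have hpq : p ≠ q := fun h => hST (congrArg _ h)
  have hlt := hconc.2 hp hq hpq ha hb hab
  have hcomb : 0 ≤ a • p + b • q := convex_Ici (0 : ℝ) hp hq ha.le hb.le hab
  rw [hPhi hp, hPhi hq, ← hPhi hcomb]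
  exact hPhiMono hmem (hmem.trans hlt.le) hlt
end

section
/- The function Φ₃ is strictly increasing and strictly convex in S on [0, ∞). -/
open MeasureTheory Real Set

/-- The minimum average transmission-power-to-noise ratio achieving spectral efficiency `S`
for a fast-varying channel with channel state information at the transmitter:
the infimum of `∫ p(g) dμ(g)` over measurable power allocations `p ≥ 0` whose achieved
spectral efficiency `∫ log₂(1 + g·p(g)) dμ(g)` is at least `S`. -/
noncomputable def Phi3 (μ : Measure ℝ) (S : ℝ) : ℝ :=
  sInf {x : ℝ | 0 ≤ x ∧ ∃ p : ℝ → ℝ, Measurable p ∧ (∀ g, 0 ≤ p g) ∧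
    ENNReal.ofReal S ≤ ∫⁻ g, ENNReal.ofReal (logb 2 (1 + g * p g)) ∂μ ∧
    ENNReal.ofReal x = ∫⁻ g, ENNReal.ofReal (p g) ∂μ}

/-- A function on `[0, ∞)` admitting at every positive point a supporting line, with slopes
strictly increasing in the point, is strictly convex. -/
theorem strictConvexOn_Ici_of_support {f m : ℝ → ℝ}
    (hm : ∀ z w, 0 < z → z < w → m z < m w)
    (hf : ∀ z y, 0 < z → 0 ≤ y → f z + m z * (y - z) ≤ f y) :
    StrictConvexOn ℝ (Ici 0) f := by
  refine LinearOrder.strictConvexOn_of_lt (convex_Ici 0) fun x hx y hy hxy a b ha hb hab => ?_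
  rw [mem_Ici] at hx hy
  simp only [smul_eq_mul]
  set z := a * x + b * y with hz
  have ha' : a = 1 - b := by linarith
  have hzx : z - x = b * (y - x) := by rw [hz, ha']; ring
  have hyz : y - z = a * (y - x) := by rw [hz, ha']; ring
  have hxz : x < z := by have := mul_pos hb (sub_pos.2 hxy); linarith
  have hzy : z < y := by have := mul_pos ha (sub_pos.2 hxy); linarith
  have hz0 : 0 < z := hx.trans_lt hxz
  obtain ⟨w, hzw, hwy⟩ := exists_between hzy
  have h₁ := hf z w hz0 (hz0.trans hzw).le
  have h₂ := hf w y (hz0.trans hzw) hy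
  have h₃ := hf z x hz0 hx
  have h₄ := mul_pos (sub_pos.2 (hm z w hz0 hzw)) (sub_pos.2 hwy)
  have h₅ : f z + m z * (y - z) < f y := by linarith
  have h₆ := mul_le_mul_of_nonneg_left h₃ ha.le
  have h₇ := mul_lt_mul_of_pos_left h₅ hb
  have h₈ : a * (f z + m z * (x - z)) + b * (f z + m z * (y - z)) = f z := by
    rw [hz, ha']; ring
  linarith

/-- The water-filling power allocation with water level `c`. -/
noncomputable def waterFill (c g : ℝ) : ℝ := max 0 (c - g⁻¹)

/-- The spectral efficiency achieved at gain `g` by water-filling with water level `c`. -/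
noncomputable def waterRate (c g : ℝ) : ℝ := logb 2 (max 1 (c * g))

theorem measurable_waterFill (c : ℝ) : Measurable (waterFill c) := by
  unfold waterFill; fun_prop

theorem measurable_waterRate (c : ℝ) : Measurable (waterRate c) := by
  unfold waterRate Real.logb; fun_prop

theorem waterFill_nonneg (c g : ℝ) : 0 ≤ waterFill c g := le_max_left _ _

theorem waterRate_nonneg (c g : ℝ) : 0 ≤ waterRate c g :=
  logb_nonneg one_lt_two (le_max_left _ _)

theorem waterRate_mono {c d g : ℝ} (hg : 0 ≤ g) (h : c ≤ d) : waterRate c g ≤ waterRate d g :=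
  logb_le_logb_of_le one_lt_two (by positivity)
    (max_le_max le_rfl (mul_le_mul_of_nonneg_right h hg))

theorem waterRate_le {c g : ℝ} (hc : 0 ≤ c) (hg : 0 ≤ g) : waterRate c g ≤ c * g / log 2 := by
  refine div_le_div_of_nonneg_right ?_ (log_nonneg one_le_two)
  have h := log_le_sub_one_of_pos (x := max 1 (c * g)) (by positivity)
  have : max 1 (c * g) ≤ 1 + c * g := max_le (by nlinarith) (by linarith)
  linarith

theorem continuous_waterRate (g : ℝ) : Continuous fun c => waterRate c g := by
  unfold waterRate Real.logb
  refine (Continuous.log (by fun_prop) fun c => ?_).div_const _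
  positivity

theorem one_add_mul_waterFill {c g : ℝ} (hg : 0 < g) :
    1 + g * waterFill c g = max 1 (c * g) := by
  rw [waterFill, mul_max_of_nonneg _ _ hg.le, ← max_add_add_left, mul_sub,
    mul_inv_cancel₀ hg.ne']
  ring_nf

/-- The tangent line inequality for the logarithm at the water-filling allocation. -/
theorem logb_one_add_mul_le {c g p : ℝ} (hc : 0 < c) (hg : 0 < g) (hp : 0 ≤ p) :
    logb 2 (1 + g * p) ≤ waterRate c g + (p - waterFill c g) / (c * log 2) := by
  have hM : 0 < max 1 (c * g) := by positivity
  have hq := one_add_mul_waterFill (c := c) hg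
  have hgp : 0 < 1 + g * p := by positivity
  have h : log (1 + g * p) ≤ log (max 1 (c * g)) + (p - waterFill c g) / c := by
    have h₁ := log_le_sub_one_of_pos (div_pos hgp hM)
    rw [log_div hgp.ne' hM.ne'] at h₁
    suffices (1 + g * p) / max 1 (c * g) - 1 ≤ (p - waterFill c g) / c by linarith
    rw [div_sub_one hM.ne', div_le_div_iff₀ hM hc]
    rcases le_total 1 (c * g) with h | h
    · rw [max_eq_right h] at hq ⊢
      nlinarith
    · rw [max_eq_left h] at hq ⊢
      have : waterFill c g = 0 := by
        rcases mul_eq_zero.1 (by linarith : g * waterFill c g = 0) with h0 | h0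
        · exact absurd h0 hg.ne'
        · exact h0
      rw [this]
      nlinarith
  have h2 := log_pos one_lt_two
  rw [waterRate, logb, logb, ← div_div, ← add_div]
  exact div_le_div_of_nonneg_right h h2.le

theorem ae_pos_of_measure_Iic {μ : Measure ℝ} (hsupp : μ (Iic 0) = 0) : ∀ᵐ g ∂μ, 0 < g := by
  rw [ae_iff]; simpa [not_lt, Iic] using hsupp

/-- The set of average powers whose infimum is `Phi3 μ S`. -/
def feasiblePowers (μ : Measure ℝ) (S : ℝ) : Set ℝ :=
  {x : ℝ | 0 ≤ x ∧ ∃ p : ℝ → ℝ, Measurable p ∧ (∀ g, 0 ≤ p g) ∧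
    ENNReal.ofReal S ≤ ∫⁻ g, ENNReal.ofReal (logb 2 (1 + g * p g)) ∂μ ∧
    ENNReal.ofReal x = ∫⁻ g, ENNReal.ofReal (p g) ∂μ}

theorem Phi3_nonneg (μ : Measure ℝ) (S : ℝ) : 0 ≤ Phi3 μ S := Real.sInf_nonneg fun _ hx => hx.1

theorem Phi3_le_of_mem {μ : Measure ℝ} {S x : ℝ} (hx : x ∈ feasiblePowers μ S) : Phi3 μ S ≤ x :=
  csInf_le ⟨0, fun _ hy => hy.1⟩ hx

theorem integrable_waterRate {μ : Measure ℝ} (hsupp : μ (Iic 0) = 0)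
    (hmean : Integrable id μ) {c : ℝ} (hc : 0 ≤ c) : Integrable (waterRate c) μ := by
  refine ((hmean.const_mul c).div_const (log 2)).mono'
    (measurable_waterRate c).aestronglyMeasurable ?_
  filter_upwards [ae_pos_of_measure_Iic hsupp] with g hg
  rw [norm_of_nonneg (waterRate_nonneg c g)]
  exact waterRate_le hc hg.le

theorem integral_waterRate_mono {μ : Measure ℝ} (hsupp : μ (Iic 0) = 0)
    (hmean : Integrable id μ) {c d : ℝ} (hc : 0 ≤ c) (h : c ≤ d) :
    ∫ g, waterRate c g ∂μ ≤ ∫ g, waterRate d g ∂μ := by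
  refine integral_mono_ae (integrable_waterRate hsupp hmean hc)
    (integrable_waterRate hsupp hmean (hc.trans h)) ?_
  filter_upwards [ae_pos_of_measure_Iic hsupp] with g hg using waterRate_mono hg.le h

section

variable {μ : Measure ℝ} [IsProbabilityMeasure μ]

theorem integrable_waterFill (hsupp : μ (Iic 0) = 0) {c : ℝ} (hc : 0 ≤ c) :
    Integrable (waterFill c) μ := by
  refine (integrable_const c).mono' (measurable_waterFill c).aestronglyMeasurable ?_
  filter_upwards [ae_pos_of_measure_Iic hsupp] with g hg
  rw [norm_of_nonneg (waterFill_nonneg c g)]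
  exact max_le hc (by have := inv_pos.2 hg; linarith)

theorem exists_le_integral_waterRate (hsupp : μ (Iic 0) = 0) (hmean : Integrable id μ)
    (S : ℝ) : ∃ c, 0 ≤ c ∧ S ≤ ∫ g, waterRate c g ∂μ := by
  obtain ⟨n, hn⟩ : ∃ n : ℕ, 0 < μ (Ici (1 / ((n : ℝ) + 1))) := by
    by_contra! h
    have h0 : μ (⋃ n : ℕ, Ici (1 / ((n : ℝ) + 1))) = 0 :=
      measure_iUnion_null fun n => nonpos_iff_eq_zero.1 (h n)
    have h1 : μ univ = 0 := by
      refine measure_mono_null (fun g _ => ?_) (measure_union_null hsupp h0)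
      rcases le_or_gt g 0 with hg | hg
      · exact Or.inl hg
      · obtain ⟨n, hn⟩ := exists_nat_one_div_lt hg
        exact Or.inr (mem_iUnion.2 ⟨n, hn.le⟩)
    simp at h1
  set ε : ℝ := 1 / ((n : ℝ) + 1)
  have hε : 0 < ε := by positivity
  have hm : 0 < μ.real (Ici ε) := ENNReal.toReal_pos hn.ne' (measure_ne_top _ _)
  set T := S / μ.real (Ici ε)
  have hc : 0 ≤ (2 : ℝ) ^ T / ε := by positivity
  refine ⟨2 ^ T / ε, hc, ?_⟩
  calc S = ∫ g, (Ici ε).indicator (fun _ => T) g ∂μ := by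
        rw [integral_indicator_const _ measurableSet_Ici, smul_eq_mul, mul_div_cancel₀ _ hm.ne']
    _ ≤ ∫ g, waterRate (2 ^ T / ε) g ∂μ := by
        refine integral_mono ((integrable_const T).indicator measurableSet_Ici)
          (integrable_waterRate hsupp hmean hc) fun g => ?_
        by_cases hg : g ∈ Ici ε
        · rw [indicator_of_mem hg, waterRate,
            le_logb_iff_rpow_le one_lt_two (by positivity)]
          refine le_max_of_le_right ?_
          rw [div_mul_eq_mul_div, le_div_iff₀ hε]
          exact mul_le_mul_of_nonneg_left hg (by positivity)
        · rw [indicator_of_notMem hg]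
          exact waterRate_nonneg _ _

theorem exists_integral_waterRate_eq (hsupp : μ (Iic 0) = 0) (hmean : Integrable id μ) {S : ℝ}
    (hS : 0 ≤ S) : ∃ c, 0 ≤ c ∧ ∫ g, waterRate c g ∂μ = S := by
  obtain ⟨d, hd, hSd⟩ := exists_le_integral_waterRate hsupp hmean S
  have hcont : ContinuousOn (fun c => ∫ g, waterRate c g ∂μ) (Icc 0 d) := by
    refine continuousOn_of_dominated (bound := waterRate d)
      (fun c _ => (measurable_waterRate c).aestronglyMeasurable) (fun c hc => ?_)
      (integrable_waterRate hsupp hmean hd)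
      (Filter.Eventually.of_forall fun g => (continuous_waterRate g).continuousOn)
    filter_upwards [ae_pos_of_measure_Iic hsupp] with g hg
    rw [norm_of_nonneg (waterRate_nonneg c g)]
    exact waterRate_mono hg.le hc.2
  have h0 : ∫ g, waterRate 0 g ∂μ = 0 := by simp [waterRate]
  obtain ⟨c, hc, hcS⟩ := intermediate_value_Icc hd hcont ⟨h0.le.trans hS, hSd⟩
  exact ⟨c, hc.1, hcS⟩

theorem integral_waterFill_mem (hsupp : μ (Iic 0) = 0) (hmean : Integrable id μ) {c : ℝ}
    (hc : 0 ≤ c) :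
    ∫ g, waterFill c g ∂μ ∈ feasiblePowers μ (∫ g, waterRate c g ∂μ) := by
  refine ⟨integral_nonneg (waterFill_nonneg c), waterFill c, measurable_waterFill c,
    waterFill_nonneg c, ?_, ?_⟩
  · rw [ofReal_integral_eq_lintegral_ofReal (integrable_waterRate hsupp hmean hc)
      (Filter.Eventually.of_forall (waterRate_nonneg c))]
    refine (lintegral_congr_ae ?_).le
    filter_upwards [ae_pos_of_measure_Iic hsupp] with g hg
    rw [one_add_mul_waterFill hg, waterRate]
  · exact ofReal_integral_eq_lintegral_ofReal (integrable_waterFill hsupp hc)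
      (Filter.Eventually.of_forall (waterFill_nonneg c))

theorem Phi3_zero : Phi3 μ 0 = 0 :=
  le_antisymm (Phi3_le_of_mem ⟨le_rfl, 0, measurable_zero, fun _ => le_rfl, by simp, by simp⟩)
    (Phi3_nonneg μ 0)

theorem le_of_mem_feasiblePowers (hsupp : μ (Iic 0) = 0) (hmean : Integrable id μ) {c S x : ℝ}
    (hc : 0 < c) (hx : x ∈ feasiblePowers μ S) :
    ∫ g, waterFill c g ∂μ + c * log 2 * (S - ∫ g, waterRate c g ∂μ) ≤ x := by
  obtain ⟨hx0, p, hpm, hp0, hS, hpx⟩ := hx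
  have hpos := ae_pos_of_measure_Iic hsupp
  have hp : Integrable p μ := by
    refine ⟨hpm.aestronglyMeasurable, ?_⟩
    rw [hasFiniteIntegral_iff_ofReal (Filter.Eventually.of_forall hp0), ← hpx]
    exact ENNReal.ofReal_lt_top
  have hpi : ∫ g, p g ∂μ = x := by
    rw [integral_eq_lintegral_of_nonneg_ae (Filter.Eventually.of_forall hp0)
      hpm.aestronglyMeasurable, ← hpx, ENNReal.toReal_ofReal hx0]
  have hF := integrable_waterFill (μ := μ) hsupp hc.le
  have hR := integrable_waterRate (μ := μ) hsupp hmean hc.le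
  have hD : Integrable (fun g => (p g - waterFill c g) / (c * log 2)) μ :=
    (hp.sub hF).div_const _
  have hRD : Integrable (fun g => waterRate c g + (p g - waterFill c g) / (c * log 2)) μ :=
    hR.add hD
  have h0 : 0 ≤ᵐ[μ] fun g => waterRate c g + (p g - waterFill c g) / (c * log 2) := by
    filter_upwards [hpos] with g hg
    refine le_trans ?_ (logb_one_add_mul_le hc hg (hp0 g))
    exact logb_nonneg one_lt_two (by have := mul_nonneg hg.le (hp0 g); linarith)
  have hle : ENNReal.ofReal S ≤ ENNReal.ofReal
      (∫ g, (waterRate c g + (p g - waterFill c g) / (c * log 2)) ∂μ) := by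
    rw [ofReal_integral_eq_lintegral_ofReal hRD h0]
    refine hS.trans (lintegral_mono_ae ?_)
    filter_upwards [hpos] with g hg
    exact ENNReal.ofReal_le_ofReal (logb_one_add_mul_le hc hg (hp0 g))
  rw [ENNReal.ofReal_le_ofReal_iff (integral_nonneg_of_ae h0), integral_add hR hD,
    integral_div, integral_sub hp hF, hpi] at hle
  have hk : 0 < c * log 2 := mul_pos hc (log_pos one_lt_two)
  have := (le_div_iff₀' hk).1 (sub_le_iff_le_add'.2 hle)
  linarith

theorem Phi3_support (hsupp : μ (Iic 0) = 0) (hmean : Integrable id μ) {c S : ℝ}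
    (hc : 0 < c) (hS : 0 ≤ S) :
    Phi3 μ (∫ g, waterRate c g ∂μ) + c * log 2 * (S - ∫ g, waterRate c g ∂μ) ≤ Phi3 μ S := by
  obtain ⟨d, hd, hdS⟩ := exists_integral_waterRate_eq hsupp hmean hS
  have hne : (feasiblePowers μ S).Nonempty :=
    ⟨_, hdS ▸ integral_waterFill_mem hsupp hmean hd⟩
  refine le_csInf hne fun x hx => ?_
  have h₁ := Phi3_le_of_mem (integral_waterFill_mem hsupp hmean hc.le)
  have h₂ := le_of_mem_feasiblePowers hsupp hmean hc hx
  linarith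

end

/-- `Φ₃` is strictly increasing and strictly convex on `[0, ∞)`, where `μ` is a
probability measure on `(0,∞)` (the channel power gain distribution) with finite mean. -/
theorem stmt_2 (μ : Measure ℝ) [IsProbabilityMeasure μ]
    (hsupp : μ (Iic 0) = 0) (hmean : Integrable id μ) :
    StrictMonoOn (Phi3 μ) (Ici 0) ∧ StrictConvexOn ℝ (Ici 0) (Phi3 μ) := by
  have hlevel : ∀ z : ℝ, ∃ c, 0 < z → 0 < c ∧ ∫ g, waterRate c g ∂μ = z := by
    intro z
    by_cases hz : 0 < z
    · obtain ⟨c, hc, hcz⟩ := exists_integral_waterRate_eq hsupp hmean hz.le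
      refine ⟨c, fun _ => ⟨hc.lt_of_ne' ?_, hcz⟩⟩
      rintro rfl
      simp [waterRate] at hcz
      exact hz.ne hcz
    · exact ⟨0, fun h => absurd h hz⟩
  choose level hlevel using hlevel
  have h2 : 0 < log 2 := log_pos one_lt_two
  have hsub : ∀ z y, 0 < z → 0 ≤ y →
      Phi3 μ z + level z * log 2 * (y - z) ≤ Phi3 μ y := by
    intro z y hz hy
    have h := Phi3_support hsupp hmean (hlevel z hz).1 hy
    rwa [(hlevel z hz).2] at h
  have hlt : ∀ z y, 0 < z → z < y → Phi3 μ z < Phi3 μ y := by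
    intro z y hz hzy
    have h₁ := hsub z y hz (hz.trans hzy).le
    have h₂ := mul_pos (mul_pos (hlevel z hz).1 h2) (sub_pos.2 hzy)
    linarith
  refine ⟨fun x hx y _ hxy => ?_, strictConvexOn_Ici_of_support
    (m := fun z => level z * log 2) (fun z w hz hzw => ?_) hsub⟩
  · rcases (mem_Ici.1 hx).eq_or_lt with rfl | hx
    · rw [Phi3_zero]
      exact (Phi3_nonneg μ (y / 2)).trans_lt (hlt _ _ (half_pos hxy) (half_lt_self hxy))
    · exact hlt x y hx hxy
  · refine mul_lt_mul_of_pos_right ?_ h2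
    by_contra! h
    have hw := hlevel w (hz.trans hzw)
    have := integral_waterRate_mono hsupp hmean hw.1.le h
    rw [hw.2, (hlevel z hz).2] at this
    exact this.not_gt hzw
end

section
/- Let p₁, p₂ : (0,∞) → [0,∞) be measurable functions such that ∫ log₂(1 + g·p₁(g)) dμ(g) and ∫ log₂(1 + g·p₂(g)) dμ(g) are finite and p₁ ≠ p₂ on a set of positive μ-measure. Then for every α ∈ (0,1), ∫ log₂(1 + g·(α·p₁(g) + (1−α)·p₂(g))) dμ(g) > α·∫ log₂(1 + g·p₁(g)) dμ(g) + (1−α)·∫ log₂(1 + g·p₂(g)) dμ(g); that is, the achievable spectral efficiency is a strictly concave functional of the power-allocation strategy. -/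
open MeasureTheory Real Set

/-- The logarithm to a base `b > 1` is strictly concave on the positive reals. -/
theorem strictConcaveOn_logb_Ioi {b : ℝ} (hb : 1 < b) :
    StrictConcaveOn ℝ (Ioi 0) (logb b) := by
  refine ⟨convex_Ioi 0, fun x hx y hy hxy a c ha hc hac => ?_⟩
  have h := strictConcaveOn_log_Ioi.2 hx hy hxy ha hc hac
  simp only [smul_eq_mul, logb] at h ⊢
  rw [← mul_div_assoc, ← mul_div_assoc, ← add_div]
  exact div_lt_div_of_pos_right h (log_pos hb)

/-- If `log (1 + u)` and `log (1 + v)` are integrable, then so is `log (1 + w)` for every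
measurable `0 ≤ w ≤ u + v`. -/
theorem integrable_logb_one_add_of_le_add {Ω : Type*} [MeasurableSpace Ω] {μ : Measure Ω}
    {b : ℝ} (hb : 1 < b) {u v w : Ω → ℝ} (hw : AEMeasurable w μ)
    (hu0 : ∀ᵐ x ∂μ, 0 ≤ u x) (hv0 : ∀ᵐ x ∂μ, 0 ≤ v x) (hw0 : ∀ᵐ x ∂μ, 0 ≤ w x)
    (hle : ∀ᵐ x ∂μ, w x ≤ u x + v x)
    (hu : Integrable (fun x => logb b (1 + u x)) μ)
    (hv : Integrable (fun x => logb b (1 + v x)) μ) :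
    Integrable (fun x => logb b (1 + w x)) μ := by
  refine (hu.add hv).mono' ?_ ?_
  · exact ((measurable_log.comp_aemeasurable (hw.const_add 1)).div_const _).aestronglyMeasurable
  · filter_upwards [hu0, hv0, hw0, hle] with x hux hvx hwx hx
    rw [Real.norm_of_nonneg (logb_nonneg hb (by linarith)), Pi.add_apply,
      ← logb_mul (by positivity) (by positivity)]
    exact logb_le_logb_of_le hb (by positivity) (by nlinarith [mul_nonneg hux hvx])

/-- The achievable spectral efficiency `p ↦ ∫ log₂(1 + g·p(g)) dμ(g)` is a strictly
concave functional of the power-allocation strategy: for measurable `p₁, p₂ ≥ 0` with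
finite achieved spectral efficiencies that differ on a set of positive `μ`-measure,
and any `α ∈ (0,1)`, the spectral efficiency of the convex combination strictly exceeds
the convex combination of the spectral efficiencies.  Here `μ` is a probability measure
on `(0,∞)` with finite mean. -/
theorem stmt_3 (μ : Measure ℝ) [IsProbabilityMeasure μ]
    (hsupp : μ (Iic 0) = 0) (hmean : Integrable id μ)
    (p₁ p₂ : ℝ → ℝ) (hm₁ : Measurable p₁) (hm₂ : Measurable p₂)
    (hp₁ : ∀ g, 0 ≤ p₁ g) (hp₂ : ∀ g, 0 ≤ p₂ g)
    (hi₁ : Integrable (fun g => logb 2 (1 + g * p₁ g)) μ)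
    (hi₂ : Integrable (fun g => logb 2 (1 + g * p₂ g)) μ)
    (hne : ¬ p₁ =ᵐ[μ] p₂)
    (α : ℝ) (hα : α ∈ Ioo (0:ℝ) 1) :
    α * ∫ g, logb 2 (1 + g * p₁ g) ∂μ + (1 - α) * ∫ g, logb 2 (1 + g * p₂ g) ∂μ
      < ∫ g, logb 2 (1 + g * (α * p₁ g + (1 - α) * p₂ g)) ∂μ := by
  obtain ⟨hα0, hα1⟩ := hα
  have hβ : 0 < 1 - α := sub_pos.2 hα1
  have hpos : ∀ᵐ g ∂μ, 0 < g := by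
    filter_upwards [measure_eq_zero_iff_ae_notMem.1 hsupp] with g hg
    exact not_le.1 hg
  have hmix (g : ℝ) : 1 + g * (α * p₁ g + (1 - α) * p₂ g)
      = α * (1 + g * p₁ g) + (1 - α) * (1 + g * p₂ g) := by ring
  have hlt : ∀ g, 0 < g → p₁ g ≠ p₂ g →
      α * logb 2 (1 + g * p₁ g) + (1 - α) * logb 2 (1 + g * p₂ g)
        < logb 2 (1 + g * (α * p₁ g + (1 - α) * p₂ g)) := by
    intro g hg hpg
    have h₁ : 0 < 1 + g * p₁ g := by have := hp₁ g; positivity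
    have h₂ : 0 < 1 + g * p₂ g := by have := hp₂ g; positivity
    rw [hmix]
    refine (strictConcaveOn_logb_Ioi one_lt_two).2 h₁ h₂ (fun h => hpg ?_) hα0 hβ (by ring)
    exact mul_left_cancel₀ hg.ne' (add_left_cancel h)
  have hint : Integrable (fun g => logb 2 (1 + g * (α * p₁ g + (1 - α) * p₂ g))) μ := by
    refine integrable_logb_one_add_of_le_add one_lt_two (by fun_prop) ?_ ?_ ?_ ?_ hi₁ hi₂
    all_goals
      filter_upwards [hpos] with g hg
      have h₁ := mul_nonneg hg.le (hp₁ g)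
      have h₂ := mul_nonneg hg.le (hp₂ g)
      nlinarith [mul_nonneg hα0.le h₁, mul_nonneg hβ.le h₂, mul_nonneg hβ.le h₁,
        mul_nonneg hα0.le h₂]
  rw [← integral_const_mul, ← integral_const_mul,
    ← integral_add (hi₁.const_mul α) (hi₂.const_mul (1 - α))]
  have hsum := (hi₁.const_mul α).add (hi₂.const_mul (1 - α))
  have hle : (fun g => α * logb 2 (1 + g * p₁ g) + (1 - α) * logb 2 (1 + g * p₂ g))
      ≤ᵐ[μ] fun g => logb 2 (1 + g * (α * p₁ g + (1 - α) * p₂ g)) := by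
    filter_upwards [hpos] with g hg
    by_cases hpg : p₁ g = p₂ g
    · refine le_of_eq ?_
      rw [hmix, hpg, ← add_mul, ← add_mul, add_sub_cancel, one_mul, one_mul]
    · exact (hlt g hg hpg).le
  refine (integral_mono_ae hsum hint hle).lt_of_ne fun heq => hne ?_
  filter_upwards [hpos, (integral_eq_iff_of_ae_le hsum hint hle).1 heq] with g hg hgeq
  by_contra hpg
  exact (hlt g hg hpg).ne hgeq
end

section
/- If P : [0,∞) → ℝ is strictly convex, P(0) > 0, and P(S) > 0 for all S ≥ 0, then the function E(S) = P(S)/S is strictly quasiconvex on (0,∞): for all 0 < S₁ < S < S₂, E(S) < max{E(S₁), E(S₂)}. -/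
open Set

/-- If `P : [0,∞) → ℝ` is strictly convex, `P 0 > 0` and `P S > 0` for all `S ≥ 0`,
then `E(S) = P(S)/S` is strictly quasiconvex on `(0,∞)`:
for all `0 < S₁ < S < S₂`, `E(S) < max (E S₁) (E S₂)`. -/
theorem stmt_4 (P : ℝ → ℝ) (hconv : StrictConvexOn ℝ (Ici 0) P)
    (hP0 : 0 < P 0) (hPpos : ∀ S : ℝ, 0 ≤ S → 0 < P S) :
    ∀ S₁ S S₂ : ℝ, 0 < S₁ → S₁ < S → S < S₂ →
      P S / S < max (P S₁ / S₁) (P S₂ / S₂) := by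
  intro S₁ S S₂ h₁ hl hr
  have hS : 0 < S := h₁.trans hl
  have h₂ : 0 < S₂ := hS.trans hr
  by_contra! hmax
  obtain ⟨hm₁, hm₂⟩ := max_le_iff.mp hmax
  rw [div_le_iff₀ h₁] at hm₁
  rw [div_le_iff₀ h₂] at hm₂
  have hmem : S ∈ openSegment ℝ S₁ S₂ := by
    rw [openSegment_eq_Ioo (hl.trans hr)]
    exact ⟨hl, hr⟩
  obtain ⟨a, b, ha, hb, hab, hcomb⟩ := hmem
  have hlt := hconv.2 (mem_Ici.mpr h₁.le) (mem_Ici.mpr h₂.le) (hl.trans hr).ne ha hb hab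
  rw [hcomb] at hlt
  simp only [smul_eq_mul] at hlt hcomb
  have hle : a * P S₁ + b * P S₂ ≤ P S :=
    calc a * P S₁ + b * P S₂ ≤ a * (P S / S * S₁) + b * (P S / S * S₂) := by gcongr
      _ = P S / S * (a * S₁ + b * S₂) := by ring
      _ = P S := by rw [hcomb, div_mul_cancel₀ _ hS.ne']
  exact hlt.not_ge hle
end

section
/- Define Γ(S) = κ·g(W·S) + c·f(S) − Pc, where g(R) = R·φ'(R) − φ(R) and f(S) = S·Φ'(S) − Φ(S), and let S* be the optimum spectral efficiency. Then for every S > 0: S < S* if and only if Γ(S) < 0; S = S* if and only if Γ(S) = 0; and S > S* if and only if Γ(S) > 0. -/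
open Set Filter

/-- For a convex function on `[0, ∞)`, the map `x ↦ x * f' x - f x` is monotone. -/
lemma ConvexOn.monotoneOn_mul_deriv_sub {f f' : ℝ → ℝ} (hf : ConvexOn ℝ (Ici 0) f)
    (hd : ∀ x ∈ Ici (0 : ℝ), HasDerivWithinAt f (f' x) (Ici 0) x) :
    MonotoneOn (fun x => x * f' x - f x) (Ici 0) := by
  intro x hx y hy hle
  rcases hle.eq_or_lt with rfl | hxy
  · exact le_rfl
  have h₁ := hf.le_slope_of_hasDerivWithinAt hx hy hxy (hd x hx)
  have h₂ := hf.slope_le_of_hasDerivWithinAt hx hy hxy (hd y hy)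
  have h₃ := mul_le_mul_of_nonneg_left (h₁.trans h₂) hx
  rw [slope_def_field, div_le_iff₀ (sub_pos.2 hxy)] at h₂
  dsimp only
  linarith

/-- For a strictly convex function on `[0, ∞)`, the map `x ↦ x * f' x - f x` is strictly
monotone. -/
lemma StrictConvexOn.strictMonoOn_mul_deriv_sub {f f' : ℝ → ℝ}
    (hf : StrictConvexOn ℝ (Ici 0) f)
    (hd : ∀ x ∈ Ici (0 : ℝ), HasDerivWithinAt f (f' x) (Ici 0) x) :
    StrictMonoOn (fun x => x * f' x - f x) (Ici 0) := by
  intro x hx y hy hxy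
  have h₁ := hf.lt_slope_of_hasDerivWithinAt hx hy hxy (hd x hx)
  have h₂ := hf.slope_lt_of_hasDerivWithinAt hx hy hxy (hd y hy)
  have h₃ := mul_le_mul_of_nonneg_left (h₁.trans h₂).le hx
  rw [slope_def_field, div_lt_iff₀ (sub_pos.2 hxy)] at h₂
  dsimp only
  linarith

/-- At a minimizer over `x > 0` of `p x / (w * x)`, the first-order condition
`x * p' = p x` holds. -/
lemma mul_deriv_sub_eq_zero_of_forall_div_le {p : ℝ → ℝ} {p' w x : ℝ} (hw : 0 < w) (hx : 0 < x)
    (hp : HasDerivAt p p' x) (hmin : ∀ t, 0 < t → p x / (w * x) ≤ p t / (w * t)) :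
    x * p' - p x = 0 := by
  have hwx : w * x ≠ 0 := (mul_pos hw hx).ne'
  have hloc : IsLocalMin (fun t => p t / (w * t)) x := by
    filter_upwards [Ioi_mem_nhds hx] with t ht using hmin t ht
  have h := hloc.hasDerivAt_eq_zero (hp.fun_div ((hasDerivAt_id' x).const_mul w) hwx)
  rw [div_eq_zero_iff, or_iff_left (pow_ne_zero 2 hwx)] at h
  have h' : w * (x * p' - p x) = 0 := by linear_combination h
  exact (mul_eq_zero.1 h').resolve_left hw.ne'

/-- With total power `P(S) = κ·φ(W·S) + c·Φ(S) + Pc` and optimum spectral efficiency `S*`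
(the minimizer over `S > 0` of `E(S) = P(S)/(W·S)`), define
`Γ(S) = κ·g(W·S) + c·f(S) − Pc`, where `g(R) = R·φ'(R) − φ(R)` and
`f(S) = S·Φ'(S) − Φ(S)`.  Then for every `S > 0`:
`S < S*` iff `Γ(S) < 0`; `S = S*` iff `Γ(S) = 0`; `S > S*` iff `Γ(S) > 0`. -/
theorem stmt_9 (W κ c Pc : ℝ) (hW : 0 < W) (hκ : 0 ≤ κ) (hc : 0 < c) (hPc : 0 < Pc)
    (φ φ' Φ Φ' : ℝ → ℝ)
    (hφd : ∀ R ∈ Ici (0:ℝ), HasDerivWithinAt φ (φ' R) (Ici 0) R)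
    (hφm : StrictMonoOn φ (Ici 0)) (hφc : ConvexOn ℝ (Ici 0) φ) (hφ0 : φ 0 = 0)
    (hΦd : ∀ S ∈ Ici (0:ℝ), HasDerivWithinAt Φ (Φ' S) (Ici 0) S)
    (hΦm : StrictMonoOn Φ (Ici 0)) (hΦc : StrictConvexOn ℝ (Ici 0) Φ) (hΦ0 : Φ 0 = 0)
    (hΦinf : Tendsto (fun S => Φ S / S) atTop atTop)
    (Sstar : ℝ) (hSpos : 0 < Sstar)
    (hmin : ∀ T : ℝ, 0 < T →
      (κ * φ (W * Sstar) + c * Φ Sstar + Pc) / (W * Sstar)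
        ≤ (κ * φ (W * T) + c * Φ T + Pc) / (W * T)) :
    ∀ S : ℝ, 0 < S →
      ((S < Sstar ↔ κ * (W * S * φ' (W * S) - φ (W * S)) + c * (S * Φ' S - Φ S) - Pc < 0) ∧
       (S = Sstar ↔ κ * (W * S * φ' (W * S) - φ (W * S)) + c * (S * Φ' S - Φ S) - Pc = 0) ∧
       (Sstar < S ↔ 0 < κ * (W * S * φ' (W * S) - φ (W * S)) + c * (S * Φ' S - Φ S) - Pc)) := by
  have hφ := hφc.monotoneOn_mul_deriv_sub hφd
  have hΦ := hΦc.strictMonoOn_mul_deriv_sub hΦd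
  set Γ : ℝ → ℝ := fun S =>
    κ * (W * S * φ' (W * S) - φ (W * S)) + c * (S * Φ' S - Φ S) - Pc with hΓ
  have hmono : StrictMonoOn Γ (Ioi 0) := by
    intro x hx y hy hxy
    have hx' : 0 < x := hx
    have hy' : 0 < y := hy
    have h₁ := mul_le_mul_of_nonneg_left (hφ (mul_pos hW hx').le (mul_pos hW hy').le
      (mul_le_mul_of_nonneg_left hxy.le hW.le)) hκ
    have h₂ := mul_lt_mul_of_pos_left (hΦ hx'.le hy'.le hxy) hc
    simp only [hΓ]
    linarith
  have hzero : Γ Sstar = 0 := by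
    have hWS := mul_pos hW hSpos
    have h₁ := (hφd _ hWS.le).hasDerivAt (Ici_mem_nhds hWS)
    have h₂ := (hΦd _ hSpos.le).hasDerivAt (Ici_mem_nhds hSpos)
    have h₃ := h₁.comp Sstar ((hasDerivAt_id' Sstar).const_mul W)
    have h := mul_deriv_sub_eq_zero_of_forall_div_le hW hSpos
      (((h₃.const_mul κ).fun_add (h₂.const_mul c)).add_const Pc) hmin
    simp only [Function.comp_apply] at h
    simp only [hΓ]
    linear_combination h
  intro S hS
  change (_ ↔ Γ S < 0) ∧ (_ ↔ Γ S = 0) ∧ (_ ↔ 0 < Γ S)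
  rw [← hzero]
  exact ⟨(hmono.lt_iff_lt hS hSpos).symm, (hmono.injOn.eq_iff hS hSpos).symm,
    (hmono.lt_iff_lt hSpos hS).symm⟩
end

section
/- For 0 ≤ κ₁ < κ₂, the optimum energy efficiency strictly degrades as κ increases: min over S > 0 of [κ₂·φ(W·S) + c·Φ(S) + Pc]/(W·S) is strictly greater than min over S > 0 of [κ₁·φ(W·S) + c·Φ(S) + Pc]/(W·S). -/
open Set Filter

/-- With total power `P_κ(S) = κ·φ(W·S) + c·Φ(S) + Pc`, the optimum energy efficiency
strictly degrades as `κ` increases: for `0 ≤ κ₁ < κ₂`, the minimum over `S > 0` of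
`P_{κ₂}(S)/(W·S)` is strictly greater than the minimum over `S > 0` of `P_{κ₁}(S)/(W·S)`. -/
theorem stmt_10 (W c Pc : ℝ) (hW : 0 < W) (hc : 0 < c) (hPc : 0 < Pc)
    (φ φ' Φ Φ' : ℝ → ℝ)
    (hφd : ∀ R ∈ Ici (0:ℝ), HasDerivWithinAt φ (φ' R) (Ici 0) R)
    (hφm : StrictMonoOn φ (Ici 0)) (hφc : ConvexOn ℝ (Ici 0) φ) (hφ0 : φ 0 = 0)
    (hΦd : ∀ S ∈ Ici (0:ℝ), HasDerivWithinAt Φ (Φ' S) (Ici 0) S)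
    (hΦm : StrictMonoOn Φ (Ici 0)) (hΦc : StrictConvexOn ℝ (Ici 0) Φ) (hΦ0 : Φ 0 = 0)
    (hΦinf : Tendsto (fun S => Φ S / S) atTop atTop)
    (κ₁ κ₂ : ℝ) (hκ₁ : 0 ≤ κ₁) (hκ₁₂ : κ₁ < κ₂) :
    sInf ((fun S => (κ₁ * φ (W * S) + c * Φ S + Pc) / (W * S)) '' Ioi 0) <
    sInf ((fun S => (κ₂ * φ (W * S) + c * Φ S + Pc) / (W * S)) '' Ioi 0) := by
  have hφ : ∀ S, 0 < S → 0 < φ (W * S) := fun S hS => by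
    have hWS : 0 < W * S := mul_pos hW hS
    simpa [hφ0] using hφm (mem_Ici.2 le_rfl) (mem_Ici.2 hWS.le) hWS
  have hΦ : ∀ S, 0 < S → 0 < Φ S := fun S hS => by
    simpa [hΦ0] using hΦm (mem_Ici.2 le_rfl) (mem_Ici.2 hS.le) hS
  set f : ℝ → ℝ := fun S => (κ₁ * φ (W * S) + c * Φ S + Pc) / (W * S) with hf
  have hfpos : ∀ S, 0 < S → 0 < f S := fun S hS => by
    have h₁ := hφ S hS
    have h₂ := hΦ S hS
    simp only [hf]
    positivity
  have hle : ∀ S, 0 < S → sInf (f '' Ioi 0) ≤ f S := fun S hS =>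
    csInf_le ⟨0, by rintro _ ⟨T, hT, rfl⟩; exact (hfpos T hT).le⟩ ⟨S, hS, rfl⟩
  have hm : 0 < f 1 := hfpos 1 one_pos
  -- Below `δ` the term `Pc / (W * S)` alone exceeds `f 1 + 1`; above `δ`, convexity of `φ`
  -- bounds `φ (W * S) / (W * S)` from below.
  set δ : ℝ := Pc / (W * (f 1 + 1)) with hδ_def
  have hδ : 0 < δ := by positivity
  have hη : 0 < (κ₂ - κ₁) * (φ (W * δ) / (W * δ)) :=
    mul_pos (sub_pos.2 hκ₁₂) (div_pos (hφ δ hδ) (mul_pos hW hδ))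
  refine lt_of_lt_of_le (lt_add_of_pos_right _ (lt_min one_pos hη))
    (le_csInf (nonempty_Ioi.image _) ?_)
  rintro _ ⟨S, hS, rfl⟩
  have hS : 0 < S := hS
  have hWS : 0 < W * S := mul_pos hW hS
  have h₁ := hφ S hS
  have h₂ := hΦ S hS
  have hκ₂ : 0 < κ₂ := hκ₁.trans_lt hκ₁₂
  rcases lt_or_ge S δ with hSδ | hSδ
  · refine (add_le_add (hle 1 one_pos) (min_le_left _ _)).trans ?_
    rw [hδ_def, lt_div_iff₀ (by positivity)] at hSδ
    rw [le_div_iff₀ hWS]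
    have h₃ : 0 < κ₂ * φ (W * S) := mul_pos hκ₂ h₁
    have h₄ : 0 < c * Φ S := mul_pos hc h₂
    linarith
  · refine (add_le_add (hle S hS) (min_le_right _ _)).trans ?_
    have hslope : φ (W * δ) / (W * δ) ≤ φ (W * S) / (W * S) := by
      have h := hφc.2 (mem_Ici.2 hWS.le) (mem_Ici.2 le_rfl) (div_nonneg hδ.le hS.le)
        (sub_nonneg.2 ((div_le_one hS).2 hSδ)) (add_sub_cancel _ _)
      have heq : δ / S * (W * S) = W * δ := by field_simp
      simp only [smul_eq_mul, mul_zero, add_zero, hφ0, heq] at h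
      rw [div_le_iff₀ (mul_pos hW hδ)]
      refine h.trans_eq ?_
      field_simp
    calc f S + (κ₂ - κ₁) * (φ (W * δ) / (W * δ))
        ≤ f S + (κ₂ - κ₁) * (φ (W * S) / (W * S)) := by
          gcongr
      _ = (κ₂ * φ (W * S) + c * Φ S + Pc) / (W * S) := by
          simp only [hf]
          ring
end

section
/- If φ(R) = R for all R ≥ 0, then the optimum spectral efficiency is independent of κ: for every κ ≥ 0, S*(κ) = S₁, where S₁ > 0 is the unique solution of c·f(S₁) = Pc with f(S) = S·Φ'(S) − Φ(S). -/
open Set Filter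

/-- A convex function lies above its tangent lines. -/
theorem ConvexOn.tangent_le {s : Set ℝ} {f : ℝ → ℝ} {f' x y : ℝ} (hf : ConvexOn ℝ s f)
    (hx : x ∈ s) (hy : y ∈ s) (hd : HasDerivAt f f' x) : f x + f' * (y - x) ≤ f y := by
  rcases lt_trichotomy x y with h | rfl | h
  · have := hf.le_slope_of_hasDerivAt hx hy h hd
    rw [slope_def_field, le_div_iff₀ (sub_pos.2 h)] at this
    linarith
  · simp
  · have := hf.slope_le_of_hasDerivAt hy hx h hd
    rw [slope_def_field, div_le_iff₀ (sub_pos.2 h)] at this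
    linarith

/-- If `φ(R) = R` for all `R ≥ 0`, then the optimum spectral efficiency
`S*(κ)` (the unique minimizer over `S > 0` of
`E_κ(S) = (κ·φ(W·S) + c·Φ(S) + Pc)/(W·S)`) is independent of `κ`: for every `κ ≥ 0`,
`S*(κ) = S₁`, where `S₁ > 0` is the (unique) solution of `c·f(S₁) = Pc` with
`f(S) = S·Φ'(S) − Φ(S)`. -/
theorem stmt_12 (W c Pc : ℝ) (hW : 0 < W) (hc : 0 < c) (hPc : 0 < Pc)
    (φ φ' Φ Φ' : ℝ → ℝ)
    (hφd : ∀ R ∈ Ici (0:ℝ), HasDerivWithinAt φ (φ' R) (Ici 0) R)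
    (hφm : StrictMonoOn φ (Ici 0)) (hφc : ConvexOn ℝ (Ici 0) φ) (hφ0 : φ 0 = 0)
    (hφid : ∀ R : ℝ, 0 ≤ R → φ R = R)
    (hΦd : ∀ S ∈ Ici (0:ℝ), HasDerivWithinAt Φ (Φ' S) (Ici 0) S)
    (hΦm : StrictMonoOn Φ (Ici 0)) (hΦc : StrictConvexOn ℝ (Ici 0) Φ) (hΦ0 : Φ 0 = 0)
    (hΦinf : Tendsto (fun S => Φ S / S) atTop atTop)
    (Sstar : ℝ → ℝ)
    (hS : ∀ κ : ℝ, 0 ≤ κ → 0 < Sstar κ ∧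
      (∀ T : ℝ, 0 < T →
        (κ * φ (W * Sstar κ) + c * Φ (Sstar κ) + Pc) / (W * Sstar κ)
          ≤ (κ * φ (W * T) + c * Φ T + Pc) / (W * T)) ∧
      (∀ S' : ℝ, 0 < S' →
        (∀ T : ℝ, 0 < T →
          (κ * φ (W * S') + c * Φ S' + Pc) / (W * S')
            ≤ (κ * φ (W * T) + c * Φ T + Pc) / (W * T)) → S' = Sstar κ))
    (S₁ : ℝ) (hS₁pos : 0 < S₁) (hS₁ : c * (S₁ * Φ' S₁ - Φ S₁) = Pc) :
    ∀ κ : ℝ, 0 ≤ κ → Sstar κ = S₁ := by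
  intro κ hκ
  have tangent : ∀ T : ℝ, 0 < T → Φ S₁ + Φ' S₁ * (T - S₁) ≤ Φ T := fun T hT =>
    hΦc.convexOn.tangent_le hS₁pos.le hT.le
      ((hΦd S₁ hS₁pos.le).hasDerivAt (Ici_mem_nhds hS₁pos))
  refine ((hS κ hκ).2.2 S₁ hS₁pos fun T hT => ?_).symm
  rw [hφid _ (by positivity), hφid _ (by positivity)]
  have value : (κ * (W * S₁) + c * Φ S₁ + Pc) / (W * S₁) = κ + c * Φ' S₁ / W := by
    rw [← hS₁]
    field_simp
    ring
  have lower : κ + c * Φ' S₁ / W = (κ * (W * T) + c * Φ' S₁ * T) / (W * T) := by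
    field_simp
  rw [value, lower]
  gcongr ?_ / _
  linarith [mul_le_mul_of_nonneg_left (tangent T hT) hc.le]
end

section
/- For 0 < c₁ < c₂: (i) the optimum energy efficiency strictly degrades, i.e. min over S > 0 of [κ·φ(W·S) + c₂·Φ(S) + Pc]/(W·S) is strictly greater than min over S > 0 of [κ·φ(W·S) + c₁·Φ(S) + Pc]/(W·S); (ii) the optimum spectral efficiency strictly decreases, i.e. S*(c₂) < S*(c₁); and (iii) S*(c) → 0 as c → ∞. -/
open Set Filter

theorem StrictConvexOn.strictMonoOn_div_mul {Φ : ℝ → ℝ} {W : ℝ} (hW : 0 < W)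
    (hΦc : StrictConvexOn ℝ (Ici 0) Φ) (hΦ0 : Φ 0 = 0) :
    StrictMonoOn (fun S => Φ S / (W * S)) (Ioi 0) := by
  intro a ha b hb hab
  have ha' : 0 < a := ha
  have hb' : 0 < b := hb
  have h := hΦc.secant_strict_mono (a := 0) (x := a) (y := b) self_mem_Ici
    ha'.le hb'.le ha'.ne' hb'.ne' hab
  simp only [hΦ0, sub_zero] at h
  have h' := div_lt_div_of_pos_right h hW
  simpa only [div_div, mul_comm _ W] using h'

theorem StrictConvexOn.lt_mul_of_hasDerivAt {Φ : ℝ → ℝ} {S d : ℝ} (hS : 0 < S)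
    (hΦc : StrictConvexOn ℝ (Ici 0) Φ) (hΦ0 : Φ 0 = 0) (hd : HasDerivAt Φ d S) :
    Φ S < d * S := by
  have h := hΦc.slope_lt_of_hasDerivAt (x := 0) self_mem_Ici hS.le hS hd
  rwa [slope_def_field, hΦ0, sub_zero, sub_zero, div_lt_iff₀ hS] at h

/-- A point minimizing `A + c₁ F` and `A + c₂ F` with `c₁ ≠ c₂` is critical for `F`. -/
theorem hasDerivAt_eq_zero_of_isLocalMin_add_mul {A F : ℝ → ℝ} {a b c₁ c₂ x : ℝ}
    (hc : c₁ ≠ c₂) (hA : HasDerivAt A a x) (hF : HasDerivAt F b x)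
    (h₁ : IsLocalMin (fun y => A y + c₁ * F y) x)
    (h₂ : IsLocalMin (fun y => A y + c₂ * F y) x) : b = 0 := by
  have e₁ := h₁.hasDerivAt_eq_zero (hA.add (hF.const_mul c₁))
  have e₂ := h₂.hasDerivAt_eq_zero (hA.add (hF.const_mul c₂))
  have h : (c₁ - c₂) * b = 0 := by linarith
  exact (mul_eq_zero.mp h).resolve_left (sub_ne_zero.mpr hc)

/-- If `F` is strictly increasing and `A ≥ 0` on the positive reals, then positive minimizers of
`A + c F` tend to `0` as `c → ∞`. -/
theorem tendsto_zero_of_minimizer_add_mul {A F σ : ℝ → ℝ}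
    (hA : ∀ S, 0 < S → 0 ≤ A S) (hF : StrictMonoOn F (Ioi 0)) (hσ : ∀ c, 0 < c → 0 < σ c)
    (hmin : ∀ c, 0 < c → ∀ T, 0 < T → A (σ c) + c * F (σ c) ≤ A T + c * F T) :
    Tendsto σ atTop (nhds 0) := by
  rw [Metric.tendsto_nhds]
  intro ε hε
  have hlt : F (ε / 2) < F ε := hF (half_pos hε) hε (half_lt_self hε)
  filter_upwards [eventually_gt_atTop 0,
    eventually_gt_atTop (A (ε / 2) / (F ε - F (ε / 2)))] with c hc hcε
  rw [Real.dist_eq, sub_zero, abs_of_pos (hσ c hc)]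
  by_contra! hle
  rw [div_lt_iff₀ (sub_pos.mpr hlt)] at hcε
  have h₁ := hmin c hc (ε / 2) (half_pos hε)
  have h₂ := hA _ (hσ c hc)
  have h₃ := mul_le_mul_of_nonneg_left (hF.monotoneOn hε (hσ c hc) hle) hc.le
  linarith

/-- With total power `P_c(S) = κ·φ(W·S) + c·Φ(S) + Pc`, when the noise-to-amplifier-efficiency
ratio increases, `0 < c₁ < c₂`: (i) the optimum energy efficiency strictly degrades
(the minimum over `S > 0` of `P_{c₂}(S)/(W·S)` strictly exceeds that for `c₁`);
(ii) the optimum spectral efficiency strictly decreases: `S*(c₂) < S*(c₁)`;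
(iii) `S*(c) → 0` as `c → ∞`. -/
theorem stmt_13 (W κ Pc : ℝ) (hW : 0 < W) (hκ : 0 ≤ κ) (hPc : 0 < Pc)
    (φ φ' Φ Φ' : ℝ → ℝ)
    (hφd : ∀ R ∈ Ici (0:ℝ), HasDerivWithinAt φ (φ' R) (Ici 0) R)
    (hφm : StrictMonoOn φ (Ici 0)) (hφc : ConvexOn ℝ (Ici 0) φ) (hφ0 : φ 0 = 0)
    (hΦd : ∀ S ∈ Ici (0:ℝ), HasDerivWithinAt Φ (Φ' S) (Ici 0) S)
    (hΦm : StrictMonoOn Φ (Ici 0)) (hΦc : StrictConvexOn ℝ (Ici 0) Φ) (hΦ0 : Φ 0 = 0)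
    (hΦinf : Tendsto (fun S => Φ S / S) atTop atTop)
    (Sstar : ℝ → ℝ)
    (hS : ∀ c : ℝ, 0 < c → 0 < Sstar c ∧
      (∀ T : ℝ, 0 < T →
        (κ * φ (W * Sstar c) + c * Φ (Sstar c) + Pc) / (W * Sstar c)
          ≤ (κ * φ (W * T) + c * Φ T + Pc) / (W * T)) ∧
      (∀ S' : ℝ, 0 < S' →
        (∀ T : ℝ, 0 < T →
          (κ * φ (W * S') + c * Φ S' + Pc) / (W * S')
            ≤ (κ * φ (W * T) + c * Φ T + Pc) / (W * T)) → S' = Sstar c))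
    (c₁ c₂ : ℝ) (hc₁ : 0 < c₁) (hc₁₂ : c₁ < c₂) :
    (sInf ((fun S => (κ * φ (W * S) + c₁ * Φ S + Pc) / (W * S)) '' Ioi 0) <
     sInf ((fun S => (κ * φ (W * S) + c₂ * Φ S + Pc) / (W * S)) '' Ioi 0)) ∧
    Sstar c₂ < Sstar c₁ ∧
    Tendsto Sstar atTop (nhds 0) := by
  have hc₂ : 0 < c₂ := hc₁.trans hc₁₂
  set A : ℝ → ℝ := fun S => (κ * φ (W * S) + Pc) / (W * S) with hA
  set F : ℝ → ℝ := fun S => Φ S / (W * S) with hF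
  have hE (c S : ℝ) : (κ * φ (W * S) + c * Φ S + Pc) / (W * S) = A S + c * F S := by
    simp only [hA, hF]
    ring
  simp only [hE] at hS ⊢
  have hFmono : StrictMonoOn F (Ioi 0) := hΦc.strictMonoOn_div_mul hW hΦ0
  have hFpos (S : ℝ) (h : 0 < S) : 0 < F S :=
    div_pos (hΦ0 ▸ hΦm self_mem_Ici h.le h) (mul_pos hW h)
  have hApos (S : ℝ) (h : 0 < S) : 0 ≤ A S := by
    have hWS := mul_pos hW h
    have hφpos : 0 < φ (W * S) := hφ0 ▸ hφm self_mem_Ici hWS.le hWS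
    simp only [hA]
    positivity
  have hsInf (c : ℝ) (hc : 0 < c) : sInf ((fun S => A S + c * F S) '' Ioi 0) =
      A (Sstar c) + c * F (Sstar c) := by
    refine IsLeast.csInf_eq ⟨mem_image_of_mem _ (hS c hc).1, ?_⟩
    rintro _ ⟨T, hT, rfl⟩
    exact (hS c hc).2.1 T hT
  have hlocal (c : ℝ) (hc : 0 < c) : IsLocalMin (fun S => A S + c * F S) (Sstar c) := by
    filter_upwards [Ioi_mem_nhds (hS c hc).1] with T hT
    exact (hS c hc).2.1 T hT
  refine ⟨?_, ?_, tendsto_zero_of_minimizer_add_mul hApos hFmono (fun c hc => (hS c hc).1)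
    fun c hc => (hS c hc).2.1⟩
  · rw [hsInf c₁ hc₁, hsInf c₂ hc₂]
    have h₂ := (hS c₂ hc₂).1
    have := mul_lt_mul_of_pos_right hc₁₂ (hFpos _ h₂)
    linarith [(hS c₁ hc₁).2.1 _ h₂]
  · have h₁ := (hS c₁ hc₁).1
    have h₂ := (hS c₂ hc₂).1
    have hle : Sstar c₂ ≤ Sstar c₁ := by
      by_contra! hlt
      have := mul_lt_mul_of_pos_left (hFmono h₁ h₂ hlt) (sub_pos.mpr hc₁₂)
      linarith [(hS c₁ hc₁).2.1 _ h₂, (hS c₂ hc₂).2.1 _ h₁]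
    refine hle.lt_of_ne fun heq => ?_
    have hWS : 0 < W * Sstar c₁ := mul_pos hW h₁
    have hlin : HasDerivAt (fun S => W * S) W (Sstar c₁) := by
      simpa using (hasDerivAt_id (Sstar c₁)).const_mul W
    have hφ' : HasDerivAt φ (φ' (W * Sstar c₁)) (W * Sstar c₁) :=
      (hφd _ hWS.le).hasDerivAt (Ici_mem_nhds hWS)
    have hΦ' : HasDerivAt Φ (Φ' (Sstar c₁)) (Sstar c₁) :=
      (hΦd _ h₁.le).hasDerivAt (Ici_mem_nhds h₁)
    have hA' := (((hφ'.comp (Sstar c₁) hlin).const_mul κ).add_const Pc).div hlin hWS.ne'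
    have hF' := hΦ'.div hlin hWS.ne'
    have hcrit := hasDerivAt_eq_zero_of_isLocalMin_add_mul (A := A) (F := F) hc₁₂.ne hA' hF'
      (hlocal c₁ hc₁) (heq ▸ hlocal c₂ hc₂)
    have hpos := mul_pos hW (sub_pos.mpr (hΦc.lt_mul_of_hasDerivAt h₁ hΦ0 hΦ'))
    rw [div_eq_zero_iff] at hcrit
    rcases hcrit with h | h
    · linarith
    · exact (pow_pos hWS 2).ne' h
end

section
/- For 0 < Pc₁ < Pc₂: (i) the optimum energy efficiency strictly degrades, i.e. min over S > 0 of [κ·φ(W·S) + c·Φ(S) + Pc₂]/(W·S) is strictly greater than min over S > 0 of [κ·φ(W·S) + c·Φ(S) + Pc₁]/(W·S); (ii) the optimum spectral efficiency strictly increases, i.e. S*(Pc₂) > S*(Pc₁). Moreover S*(Pc) → 0 as Pc → 0⁺ and S*(Pc) → ∞ as Pc → ∞. -/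
open Set Filter

/-- First-order condition for a minimizer `S > 0` of `(f T + P) / (W * T)` over `T > 0`. -/
lemma mul_deriv_sub_eq_of_forall_div_le {f : ℝ → ℝ} {f' W P S : ℝ} (hW : 0 < W) (hS : 0 < S)
    (hd : HasDerivAt f f' S)
    (hmin : ∀ T, 0 < T → (f S + P) / (W * S) ≤ (f T + P) / (W * T)) :
    S * f' - f S = P := by
  have hloc : IsLocalMin (fun T => (f T + P) / (W * T)) S := by
    filter_upwards [lt_mem_nhds hS] with T hT using hmin T hT
  have hq := (hd.add_const P).fun_div ((hasDerivAt_id S).const_mul W) (mul_pos hW hS).ne'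
  have h0 := hloc.hasDerivAt_eq_zero hq
  have hne : (W * S) ^ 2 ≠ 0 := pow_ne_zero 2 (mul_pos hW hS).ne'
  rw [div_eq_zero_iff, or_iff_left (by simpa using hne)] at h0
  apply mul_left_cancel₀ hW.ne'
  simp only [id] at h0
  linarith

/-- With total power `P_{Pc}(S) = κ·φ(W·S) + c·Φ(S) + Pc`, when the rate-independent
circuit power increases, `0 < Pc₁ < Pc₂`: (i) the optimum energy efficiency strictly
degrades (the minimum over `S > 0` of `P_{Pc₂}(S)/(W·S)` strictly exceeds that for `Pc₁`);
(ii) the optimum spectral efficiency strictly increases: `S*(Pc₂) > S*(Pc₁)`.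
Moreover `S*(Pc) → 0` as `Pc → 0⁺` and `S*(Pc) → ∞` as `Pc → ∞`. -/
theorem stmt_14 (W κ c : ℝ) (hW : 0 < W) (hκ : 0 ≤ κ) (hc : 0 < c)
    (φ φ' Φ Φ' : ℝ → ℝ)
    (hφd : ∀ R ∈ Ici (0:ℝ), HasDerivWithinAt φ (φ' R) (Ici 0) R)
    (hφm : StrictMonoOn φ (Ici 0)) (hφc : ConvexOn ℝ (Ici 0) φ) (hφ0 : φ 0 = 0)
    (hΦd : ∀ S ∈ Ici (0:ℝ), HasDerivWithinAt Φ (Φ' S) (Ici 0) S)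
    (hΦm : StrictMonoOn Φ (Ici 0)) (hΦc : StrictConvexOn ℝ (Ici 0) Φ) (hΦ0 : Φ 0 = 0)
    (hΦinf : Tendsto (fun S => Φ S / S) atTop atTop)
    (Sstar : ℝ → ℝ)
    (hS : ∀ Pc : ℝ, 0 < Pc → 0 < Sstar Pc ∧
      (∀ T : ℝ, 0 < T →
        (κ * φ (W * Sstar Pc) + c * Φ (Sstar Pc) + Pc) / (W * Sstar Pc)
          ≤ (κ * φ (W * T) + c * Φ T + Pc) / (W * T)) ∧
      (∀ S' : ℝ, 0 < S' →
        (∀ T : ℝ, 0 < T →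
          (κ * φ (W * S') + c * Φ S' + Pc) / (W * S')
            ≤ (κ * φ (W * T) + c * Φ T + Pc) / (W * T)) → S' = Sstar Pc))
    (Pc₁ Pc₂ : ℝ) (hPc₁ : 0 < Pc₁) (hPc₁₂ : Pc₁ < Pc₂) :
    (sInf ((fun S => (κ * φ (W * S) + c * Φ S + Pc₁) / (W * S)) '' Ioi 0) <
     sInf ((fun S => (κ * φ (W * S) + c * Φ S + Pc₂) / (W * S)) '' Ioi 0)) ∧
    Sstar Pc₁ < Sstar Pc₂ ∧
    Tendsto Sstar (nhdsWithin 0 (Ioi 0)) (nhds 0) ∧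
    Tendsto Sstar atTop atTop := by
  set f : ℝ → ℝ := fun S => κ * φ (W * S) + c * Φ S with hf
  set f' : ℝ → ℝ := fun S => κ * (φ' (W * S) * W) + c * Φ' S
  have hmaps : MapsTo (fun S => W * S) (Ici 0) (Ici 0) := fun S hS => mul_nonneg hW.le hS
  have hfd : ∀ S ∈ Ici (0 : ℝ), HasDerivWithinAt f (f' S) (Ici 0) S := fun S hS => by
    have hWS : HasDerivWithinAt (fun S => W * S) W (Ici 0) S := by
      simpa using (hasDerivWithinAt_id S (Ici 0)).const_mul W
    exact (((hφd _ (hmaps hS)).comp S hWS hmaps).const_mul κ).add ((hΦd S hS).const_mul c)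
  have hfc : StrictConvexOn ℝ (Ici 0) f := by
    refine ⟨convex_Ici 0, fun x hx y hy hxy a b ha hb hab => ?_⟩
    have h₁ := mul_le_mul_of_nonneg_left (hφc.2 (hmaps hx) (hmaps hy) ha.le hb.le hab) hκ
    have h₂ := mul_lt_mul_of_pos_left (hΦc.2 hx hy hxy ha hb hab) hc
    simp only [smul_eq_mul, hf] at h₁ h₂ ⊢
    rw [show W * (a * x + b * y) = a * (W * x) + b * (W * y) by ring]
    linarith
  have hg := hfc.strictMonoOn_mul_deriv_sub hfd
  have hpos : ∀ P, 0 < P → 0 < Sstar P := fun P hP => (hS P hP).1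
  have hmin : ∀ P, 0 < P → ∀ T, 0 < T → (f (Sstar P) + P) / (W * Sstar P) ≤ (f T + P) / (W * T) :=
    fun P hP => (hS P hP).2.1
  have hfoc : ∀ P, 0 < P → Sstar P * f' (Sstar P) - f (Sstar P) = P := fun P hP =>
    mul_deriv_sub_eq_of_forall_div_le hW (hpos P hP)
      ((hfd _ (hpos P hP).le).hasDerivAt (Ici_mem_nhds (hpos P hP))) (hmin P hP)
  have hPc₂ : 0 < Pc₂ := hPc₁.trans hPc₁₂
  have hinf : ∀ P, 0 < P → sInf ((fun S => (f S + P) / (W * S)) '' Ioi 0) =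
      (f (Sstar P) + P) / (W * Sstar P) := fun P hP =>
    IsLeast.csInf_eq ⟨mem_image_of_mem _ (hpos P hP), forall_mem_image.2 (hmin P hP)⟩
  have hlt : ∀ x, 0 ≤ x → ∀ P, 0 < P → (Sstar P < x ↔ P < x * f' x - f x) := fun x hx P hP => by
    simpa only [hfoc P hP] using (hg.lt_iff_lt (hpos P hP).le hx).symm
  have hgt : ∀ x, 0 ≤ x → ∀ P, 0 < P → (x < Sstar P ↔ x * f' x - f x < P) := fun x hx P hP => by
    simpa only [hfoc P hP] using (hg.lt_iff_lt hx (hpos P hP).le).symm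
  refine ⟨?_, ?_, ?_, ?_⟩
  · rw [hinf _ hPc₁, hinf _ hPc₂]
    refine (hmin _ hPc₁ _ (hpos _ hPc₂)).trans_lt ?_
    have := mul_pos hW (hpos _ hPc₂)
    gcongr
  · rw [hlt _ (hpos _ hPc₂).le _ hPc₁, hfoc _ hPc₂]
    exact hPc₁₂
  · have h0 : ∀ᶠ P in nhdsWithin (0 : ℝ) (Ioi 0), 0 < P := self_mem_nhdsWithin
    refine tendsto_order.2 ⟨fun a ha => ?_, fun a ha => ?_⟩
    · filter_upwards [h0] with P hP using ha.trans (hpos P hP)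
    · have hga : 0 < a * f' a - f a := by
        simpa [hf, hφ0, hΦ0] using hg self_mem_Ici ha.le ha
      filter_upwards [h0, nhdsWithin_le_nhds (gt_mem_nhds hga)] with P hP hPa
      exact (hlt a ha.le P hP).2 hPa
  · refine tendsto_atTop.2 fun M => ?_
    filter_upwards [eventually_gt_atTop 0, eventually_gt_atTop (max M 0 * f' (max M 0) - f (max M 0))]
      with P hP hPM
    exact (le_max_left M 0).trans ((hgt _ (le_max_right M 0) P hP).2 hPM).le
end

section
/- For the static channel with channel state information at the transmitter, if the channel power gain increases, 0 < G₁ < G₂, then: (i) the optimum energy efficiency strictly improves, i.e. min over S > 0 of [κ·φ(W·S) + (c/G₂)·(2^S − 1) + Pc]/(W·S) is strictly smaller than the same minimum with G₁ in place of G₂; (ii) the optimum spectral efficiency strictly increases, i.e. S*(G₂) > S*(G₁). Moreover S*(G) → 0 as G → 0⁺. -/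
open Set Filter

lemma hasDerivAt_two_rpow_sub_one_div {x : ℝ} (hx : x ≠ 0) :
    HasDerivAt (fun S : ℝ => ((2:ℝ) ^ S - 1) / S)
      (((2:ℝ) ^ x * Real.log 2 * x - ((2:ℝ) ^ x - 1)) / x ^ 2) x := by
  have h : HasDerivAt (fun S : ℝ => (2:ℝ) ^ S - 1) ((2:ℝ) ^ x * Real.log 2) x :=
    (Real.hasStrictDerivAt_const_rpow two_pos x).hasDerivAt.sub_const 1
  have h' := h.div (hasDerivAt_id' x) hx
  rw [mul_one] at h'
  exact h'

lemma deriv_two_rpow_sub_one_div_pos {x : ℝ} (hx : 0 < x) :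
    0 < ((2:ℝ) ^ x * Real.log 2 * x - ((2:ℝ) ^ x - 1)) / x ^ 2 := by
  have hL : Real.log 2 * x ≠ 0 := (mul_pos (Real.log_pos one_lt_two) hx).ne'
  have h1 := Real.add_one_lt_exp (neg_ne_zero.mpr hL)
  have h2 := Real.exp_pos (Real.log 2 * x)
  have h3 : Real.exp (Real.log 2 * x) * Real.exp (-(Real.log 2 * x)) = 1 := by
    rw [← Real.exp_add]; simp
  rw [Real.rpow_def_of_pos two_pos]
  apply div_pos _ (by positivity)
  nlinarith [mul_lt_mul_of_pos_left h1 h2]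

lemma strictMonoOn_two_rpow_sub_one_div :
    StrictMonoOn (fun S : ℝ => ((2:ℝ) ^ S - 1) / S) (Ioi 0) := by
  refine strictMonoOn_of_deriv_pos (convex_Ioi 0)
    (fun x hx => (hasDerivAt_two_rpow_sub_one_div (ne_of_gt hx)).continuousAt.continuousWithinAt)
    fun x hx => ?_
  rw [interior_Ioi] at hx
  rw [(hasDerivAt_two_rpow_sub_one_div (ne_of_gt hx)).deriv]
  exact deriv_two_rpow_sub_one_div_pos hx

/-- A point cannot be optimal for two different weights of the transmit power. -/
lemma eq_of_isMinOn_of_isMinOn {g : ℝ → ℝ} {a b x : ℝ} (hx : 0 < x) (hg : DifferentiableAt ℝ g x)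
    (ha : IsMinOn (fun S => g S + a * (((2:ℝ) ^ S - 1) / S)) (Ioi 0) x)
    (hb : IsMinOn (fun S => g S + b * (((2:ℝ) ^ S - 1) / S)) (Ioi 0) x) : a = b := by
  have hd := hasDerivAt_two_rpow_sub_one_div hx.ne'
  have h1 := (ha.isLocalMin (Ioi_mem_nhds hx)).hasDerivAt_eq_zero
    (hg.hasDerivAt.add (hd.const_mul a))
  have h2 := (hb.isLocalMin (Ioi_mem_nhds hx)).hasDerivAt_eq_zero
    (hg.hasDerivAt.add (hd.const_mul b))
  exact mul_right_cancel₀ (deriv_two_rpow_sub_one_div_pos hx).ne' (by linarith)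

/-- Static channel with CSIT: with total power
`P_G(S) = κ·φ(W·S) + (c/G)·(2^S − 1) + Pc`, if the channel power gain increases,
`0 < G₁ < G₂`, then: (i) the optimum energy efficiency strictly improves
(the minimum over `S > 0` of `P_{G₂}(S)/(W·S)` is strictly smaller than that for `G₁`);
(ii) the optimum spectral efficiency strictly increases: `S*(G₂) > S*(G₁)`.
Moreover `S*(G) → 0` as `G → 0⁺`. -/
theorem stmt_15 (W κ c Pc : ℝ) (hW : 0 < W) (hκ : 0 ≤ κ) (hc : 0 < c) (hPc : 0 < Pc)
    (φ φ' : ℝ → ℝ)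
    (hφd : ∀ R ∈ Ici (0:ℝ), HasDerivWithinAt φ (φ' R) (Ici 0) R)
    (hφm : StrictMonoOn φ (Ici 0)) (hφc : ConvexOn ℝ (Ici 0) φ) (hφ0 : φ 0 = 0)
    (Sstar : ℝ → ℝ)
    (hS : ∀ G : ℝ, 0 < G → 0 < Sstar G ∧
      (∀ T : ℝ, 0 < T →
        (κ * φ (W * Sstar G) + c / G * ((2:ℝ) ^ Sstar G - 1) + Pc) / (W * Sstar G)
          ≤ (κ * φ (W * T) + c / G * ((2:ℝ) ^ T - 1) + Pc) / (W * T)) ∧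
      (∀ S' : ℝ, 0 < S' →
        (∀ T : ℝ, 0 < T →
          (κ * φ (W * S') + c / G * ((2:ℝ) ^ S' - 1) + Pc) / (W * S')
            ≤ (κ * φ (W * T) + c / G * ((2:ℝ) ^ T - 1) + Pc) / (W * T)) → S' = Sstar G))
    (G₁ G₂ : ℝ) (hG₁ : 0 < G₁) (hG₁₂ : G₁ < G₂) :
    (sInf ((fun S => (κ * φ (W * S) + c / G₂ * ((2:ℝ) ^ S - 1) + Pc) / (W * S)) '' Ioi 0) <
     sInf ((fun S => (κ * φ (W * S) + c / G₁ * ((2:ℝ) ^ S - 1) + Pc) / (W * S)) '' Ioi 0)) ∧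
    Sstar G₁ < Sstar G₂ ∧
    Tendsto Sstar (nhdsWithin 0 (Ioi 0)) (nhds 0) := by
  set h : ℝ → ℝ := fun S => ((2:ℝ) ^ S - 1) / S with hh
  set g : ℝ → ℝ := fun S => (κ * φ (W * S) + Pc) / (W * S) with hg
  have hsplit : ∀ G S : ℝ, (κ * φ (W * S) + c / G * ((2:ℝ) ^ S - 1) + Pc) / (W * S)
      = g S + c / G / W * h S := by
    intro G S
    simp only [hh, hg]
    rw [div_mul_div_comm, ← add_div]
    ring
  simp only [hsplit] at hS ⊢
  have hmono : StrictMonoOn h (Ioi 0) := strictMonoOn_two_rpow_sub_one_div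
  have hpos : ∀ S, 0 < S → 0 < h S := fun S hS0 =>
    div_pos (sub_pos.mpr (Real.one_lt_rpow one_lt_two hS0)) hS0
  have hgpos : ∀ S, 0 < S → 0 < g S := by
    intro S hS0
    have hWS := mul_pos hW hS0
    have hφ : 0 < φ (W * S) := hφ0 ▸ hφm self_mem_Ici hWS.le hWS
    exact div_pos (by positivity) hWS
  have hgd : ∀ S, 0 < S → DifferentiableAt ℝ g S := by
    intro S hS0
    have hWS := mul_pos hW hS0
    have hφ : DifferentiableAt ℝ φ (W * S) :=
      ((hφd _ hWS.le).hasDerivAt (Ici_mem_nhds hWS)).differentiableAt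
    have hW' : DifferentiableAt ℝ (fun S => W * S) S := by fun_prop
    exact (((hφ.comp S hW').const_mul κ).add_const Pc).div hW' hWS.ne'
  have hweight : c / G₂ / W < c / G₁ / W := by gcongr
  have hinf : ∀ G, 0 < G → sInf ((fun S => g S + c / G / W * h S) '' Ioi 0)
      = g (Sstar G) + c / G / W * h (Sstar G) := fun G hG =>
    IsLeast.csInf_eq ⟨mem_image_of_mem _ (hS G hG).1,
      forall_mem_image.mpr fun T hT => (hS G hG).2.1 T hT⟩
  have hG₂ : 0 < G₂ := hG₁.trans hG₁₂
  obtain ⟨hp₁, hm₁, -⟩ := hS G₁ hG₁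
  obtain ⟨hp₂, hm₂, -⟩ := hS G₂ hG₂
  refine ⟨?_, ?_, ?_⟩
  · rw [hinf _ hG₁, hinf _ hG₂]
    refine (hm₂ _ hp₁).trans_lt ?_
    have := mul_lt_mul_of_pos_right hweight (hpos _ hp₁)
    linarith
  · refine lt_of_le_of_ne ?_ fun heq => ?_
    · by_contra! hlt
      have := mul_pos (sub_pos.mpr hweight) (sub_pos.mpr (hmono hp₂ hp₁ hlt))
      linarith [hm₁ _ hp₂, hm₂ _ hp₁]
    · rw [← heq] at hm₂
      exact hweight.ne' (eq_of_isMinOn_of_isMinOn hp₁ (hgd _ hp₁) hm₁ hm₂)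
  · rw [Metric.tendsto_nhdsWithin_nhds]
    intro ε hε
    have hε2 : 0 < ε / 2 := half_pos hε
    have hD : 0 < h ε - h (ε / 2) := sub_pos.mpr (hmono hε2 hε (half_lt_self hε))
    have hg2 := hgpos _ hε2
    refine ⟨c / W * (h ε - h (ε / 2)) / g (ε / 2), by positivity, fun {G} hG hdist => ?_⟩
    obtain ⟨hp, hm, -⟩ := hS G hG
    have hG0 : 0 < G := hG
    rw [Real.dist_eq, sub_zero, abs_of_pos hG0, lt_div_iff₀ hg2] at hdist
    rw [Real.dist_eq, sub_zero, abs_of_pos hp]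
    by_contra! hle
    have hcost : g (ε / 2) < c / G / W * (h ε - h (ε / 2)) := by
      have : c / G / W * (h ε - h (ε / 2)) = c / W * (h ε - h (ε / 2)) / G := by ring
      rw [this, lt_div_iff₀ hG0]
      linarith
    have hle' := mul_le_mul_of_nonneg_left (hmono.monotoneOn hε hp hle)
      (by positivity : 0 ≤ c / G / W)
    linarith [hm _ hε2, hgpos _ hp]
end

section
/- Let λ > 0 and define the water-filling allocation p_λ(g) = max(λ − 1/g, 0) for g > 0, and suppose ∫ log₂(1 + g·p_λ(g)) dμ(g) = S. Then p_λ is optimal for the minimum-average-power problem at spectral efficiency S: for every measurable q : (0,∞) → [0,∞) with ∫ log₂(1 + g·q(g)) dμ(g) ≥ S, one has ∫ q(g) dμ(g) ≥ ∫ p_λ(g) dμ(g). -/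
open MeasureTheory Real Set

/-- The water-filling level maximizes the Lagrangian `x ↦ lam * log (1 + g * x) - x` on `[0, ∞)`. -/
theorem waterFilling_lagrangian_le {g lam x : ℝ} (hg : 0 < g) (hlam : 0 < lam) (hx : 0 ≤ x) :
    max (lam - 1 / g) 0 + lam * log (1 + g * x) ≤
      x + lam * log (1 + g * max (lam - 1 / g) 0) := by
  have hp : 0 ≤ max (lam - 1 / g) 0 := le_max_right _ _
  have hA : 0 < 1 + g * max (lam - 1 / g) 0 := by positivity
  have hB : 0 < 1 + g * x := by positivity
  have hlog := log_le_sub_one_of_pos (div_pos hB hA)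
  rw [log_div hB.ne' hA.ne'] at hlog
  have hslope : lam * ((1 + g * x) / (1 + g * max (lam - 1 / g) 0) - 1) ≤
      x - max (lam - 1 / g) 0 := by
    rcases le_total (lam - 1 / g) 0 with h | h
    · rw [max_eq_right h]
      have hle : lam * g ≤ 1 := by
        rw [sub_nonpos, le_div_iff₀ hg] at h
        exact h
      rw [mul_zero, add_zero, div_one]
      nlinarith
    · rw [max_eq_left h]
      have heq : 1 + g * (lam - 1 / g) = g * lam := by field_simp; ring
      rw [heq]
      apply le_of_eq
      field_simp
      ring
  nlinarith [mul_le_mul_of_nonneg_left hlog hlam.le]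

/-- The spectral efficiency of the water-filling allocation is integrable as soon as the channel
gain is. -/
theorem integrable_logb_waterFilling {μ : Measure ℝ} (hpos : ∀ᵐ g ∂μ, 0 < g)
    (hmean : Integrable id μ) {lam : ℝ} (hlam : 0 < lam) :
    Integrable (fun g : ℝ => logb 2 (1 + g * max (lam - 1 / g) 0)) μ := by
  refine (hmean.const_mul (lam / log 2)).mono'
    (Measurable.aestronglyMeasurable (by unfold logb; fun_prop)) ?_
  filter_upwards [hpos] with g hg
  have hlog2 : 0 < log 2 := log_pos one_lt_two
  have hp : 0 ≤ max (lam - 1 / g) 0 := le_max_right _ _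
  have hple : max (lam - 1 / g) 0 ≤ lam :=
    max_le (sub_le_self _ (by positivity)) hlam.le
  have hgp : 0 ≤ g * max (lam - 1 / g) 0 := by positivity
  rw [Real.norm_of_nonneg (logb_nonneg one_lt_two (by linarith)), logb, id, div_mul_eq_mul_div]
  gcongr
  have hlog := log_le_sub_one_of_pos (show 0 < 1 + g * max (lam - 1 / g) 0 by linarith)
  nlinarith

/-- Water-filling optimality: let `λ > 0`, let `p_λ(g) = max (λ − 1/g) 0`, and suppose
`∫ log₂(1 + g·p_λ(g)) dμ(g) = S`.  Then for every measurable `q : (0,∞) → [0,∞)` with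
`∫ log₂(1 + g·q(g)) dμ(g) ≥ S`, one has `∫ q(g) dμ(g) ≥ ∫ p_λ(g) dμ(g)`.
Here `μ` is a probability measure on `(0,∞)` with finite mean, and the average powers
and the spectral efficiency achieved by `q` are expressed as lower Lebesgue integrals
(so that they are meaningful, possibly infinite, for every admissible `q`). -/
theorem stmt_18 (μ : Measure ℝ) [IsProbabilityMeasure μ]
    (hsupp : μ (Iic 0) = 0) (hmean : Integrable id μ)
    (lam S : ℝ) (hlam : 0 < lam)
    (hS : ∫ g, logb 2 (1 + g * max (lam - 1 / g) 0) ∂μ = S) :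
    ∀ q : ℝ → ℝ, Measurable q → (∀ g, 0 ≤ q g) →
      ENNReal.ofReal S ≤ ∫⁻ g, ENNReal.ofReal (logb 2 (1 + g * q g)) ∂μ →
      ∫⁻ g, ENNReal.ofReal (max (lam - 1 / g) 0) ∂μ ≤ ∫⁻ g, ENNReal.ofReal (q g) ∂μ := by
  intro q hq hq0 hqS
  have hpos : ∀ᵐ g ∂μ, 0 < g := by
    filter_upwards [measure_eq_zero_iff_ae_notMem.mp hsupp] with g hg
    simpa using hg
  have hlog2 : 0 < log 2 := log_pos one_lt_two
  have hRp : ∫⁻ g, ENNReal.ofReal (logb 2 (1 + g * max (lam - 1 / g) 0)) ∂μ =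
      ENNReal.ofReal S := by
    rw [← hS]
    refine (ofReal_integral_eq_lintegral_ofReal
      (integrable_logb_waterFilling hpos hmean hlam) ?_).symm
    filter_upwards [hpos] with g hg
    have hgp : 0 ≤ g * max (lam - 1 / g) 0 := mul_nonneg hg.le (le_max_right _ _)
    exact logb_nonneg one_lt_two (by linarith)
  set c : ENNReal := ENNReal.ofReal (lam * log 2) with hc
  have hpointwise : ∀ᵐ g ∂μ, ENNReal.ofReal (max (lam - 1 / g) 0) +
      c * ENNReal.ofReal (logb 2 (1 + g * q g)) ≤ ENNReal.ofReal (q g) +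
      c * ENNReal.ofReal (logb 2 (1 + g * max (lam - 1 / g) 0)) := by
    filter_upwards [hpos] with g hg
    have hp : 0 ≤ max (lam - 1 / g) 0 := le_max_right _ _
    have hgp : 0 ≤ g * max (lam - 1 / g) 0 := by positivity
    have hgq : 0 ≤ g * q g := mul_nonneg hg.le (hq0 g)
    have hlp := logb_nonneg one_lt_two (show 1 ≤ 1 + g * max (lam - 1 / g) 0 by linarith)
    have hlq := logb_nonneg one_lt_two (show 1 ≤ 1 + g * q g by linarith)
    have hc0 : 0 ≤ lam * log 2 := by positivity
    have hscale (y : ℝ) : lam * log 2 * logb 2 y = lam * log y := by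
      rw [logb]; field_simp
    rw [hc, ← ENNReal.ofReal_mul hc0, ← ENNReal.ofReal_mul hc0,
      ← ENNReal.ofReal_add hp (mul_nonneg hc0 hlq),
      ← ENNReal.ofReal_add (hq0 g) (mul_nonneg hc0 hlp), hscale, hscale]
    exact ENNReal.ofReal_le_ofReal (waterFilling_lagrangian_le hg hlam (hq0 g))
  have hint := lintegral_mono_ae hpointwise
  rw [lintegral_add_left (by fun_prop), lintegral_add_left (by fun_prop),
    lintegral_const_mul _ (by unfold logb; fun_prop),
    lintegral_const_mul _ (by unfold logb; fun_prop), hRp] at hint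
  have hfin : c * ENNReal.ofReal S ≠ ⊤ := ENNReal.mul_ne_top ENNReal.ofReal_ne_top
    ENNReal.ofReal_ne_top
  refine (ENNReal.add_le_add_iff_right hfin).mp (le_trans ?_ hint)
  gcongr
end
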